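/- arXiv:1709.02377 — 3 statements merged into one kernel-verified Lean document; each statement's English description precedes it below -/
import Mathlib

section
/- Let g : ℤ → ℤ be a grouping function, let S be a finite multiset of integers, let j ∈ ℤ, and set q = g(j). Then rank_S(j) = rank_{g⟦S⟧}(q − 1) + rank_{S ∩ g⁻¹(q)}(j). -/
/-- `mrank S j` is the rank of `j` in the multiset `S` of integers:
the number of elements of `S` (counted with multiplicity) that are at most `j`. -/
def mrank (S : Multiset ℤ) (j : ℤ) : ℕ := (S.filter (· ≤ j)).card

/-- `mselect S k` is the select operation: the least `j : ℤ` with `k ≤ mrank S j`. -/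
noncomputable def mselect (S : Multiset ℤ) (k : ℤ) : ℤ := sInf {j : ℤ | k ≤ (mrank S j : ℤ)}

/-- `srank A j` is the rank of `j` in the (simple) set `A` of integers. -/
noncomputable def srank (A : Set ℤ) (j : ℤ) : ℕ := {i ∈ A | i ≤ j}.ncard

/-- `sselect A k` is the select operation for a set of integers. -/
noncomputable def sselect (A : Set ℤ) (k : ℤ) : ℤ := sInf {j : ℤ | k ≤ (srank A j : ℤ)}

/-- The support `⟨S⟩` of a multiset of integers, as a set. -/
def msupp (S : Multiset ℤ) : Set ℤ := {x | x ∈ S}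

/-- `rank_S(ℤ)`: the image of the function `mrank S`, as a set of integers. -/
def rankImage (S : Multiset ℤ) : Set ℤ := Set.range fun j : ℤ => (mrank S j : ℤ)

/-- A grouping function: a nondecreasing `g : ℤ → ℤ` all of whose fibers are finite. -/
def GroupingFunction (g : ℤ → ℤ) : Prop := Monotone g ∧ ∀ q : ℤ, (g ⁻¹' {q}).Finite


theorem stmt0 (g : ℤ → ℤ) (hg : GroupingFunction g) (S : Multiset ℤ) (j : ℤ) :
    mrank S j = mrank (S.map g) (g j - 1) + mrank (S.filter fun i => g i = g j) j := by
  obtain ⟨hmono, -⟩ := hg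
  simp only [mrank, ← Multiset.countP_eq_card_filter, Multiset.countP_filter]
  induction S using Multiset.induction_on with
  | empty => simp
  | cons a S ih =>
    have hlt : g a < g j → a ≤ j := fun h => (hmono.reflect_lt h).le
    have hle : a ≤ j → g a ≤ g j := fun h => hmono h
    simp only [Multiset.map_cons, Multiset.countP_cons, ih]
    split_ifs <;> omega
end

section
/- Let g : ℤ → ℤ be a grouping function, let S be a finite nonempty multiset of integers, and let k ∈ {1,…,|S|}. Then g(select_S(k)) = select_{g⟦S⟧}(k). -/
theorem mrank_map (g : ℤ → ℤ) (S : Multiset ℤ) (q : ℤ) :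
    mrank (S.map g) q = (S.filter fun i => g i ≤ q).card := by
  simp [mrank, Multiset.filter_map]

theorem isLeast_mselect (S : Multiset ℤ) {k : ℤ} (hk1 : 1 ≤ k)
    (hk2 : k ≤ (Multiset.card S : ℤ)) :
    IsLeast {j : ℤ | k ≤ (mrank S j : ℤ)} (mselect S k) := by
  have hne : {j : ℤ | k ≤ (mrank S j : ℤ)}.Nonempty := by
    obtain ⟨M, hM⟩ := S.toFinset.bddAbove
    refine ⟨M, ?_⟩
    have h : S.filter (· ≤ M) = S :=
      Multiset.filter_eq_self.2 fun i hi => hM (by simpa using hi)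
    simpa [mrank, h] using hk2
  have hbdd : BddBelow {j : ℤ | k ≤ (mrank S j : ℤ)} := by
    obtain ⟨m, hm⟩ := S.toFinset.bddBelow
    refine ⟨m, fun j hj => ?_⟩
    have hpos : 0 < (S.filter (· ≤ j)).card := by
      have : k ≤ ((S.filter (· ≤ j)).card : ℤ) := hj
      omega
    obtain ⟨i, hi⟩ := Multiset.card_pos_iff_exists_mem.1 hpos
    rw [Multiset.mem_filter] at hi
    exact (hm (by simpa using hi.1)).trans hi.2
  exact ⟨Int.csInf_mem hne hbdd, fun j hj => csInf_le hbdd hj⟩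

theorem stmt1 (g : ℤ → ℤ) (hg : GroupingFunction g) (S : Multiset ℤ) (hS : S ≠ 0)
    (k : ℤ) (hk1 : 1 ≤ k) (hk2 : k ≤ (Multiset.card S : ℤ)) :
    g (mselect S k) = mselect (S.map g) k := by
  have hleast := isLeast_mselect S hk1 hk2
  refine IsLeast.unique ⟨?_, fun q hq => ?_⟩
    (isLeast_mselect (S.map g) hk1 (by simpa using hk2))
  · have h : mrank S (mselect S k) ≤ mrank (S.map g) (g (mselect S k)) := by
      rw [mrank_map]
      exact Multiset.card_le_card (Multiset.monotone_filter_right S fun i hi => hg.1 hi)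
    exact le_trans (b := (mrank S (mselect S k) : ℤ)) hleast.1 (by exact_mod_cast h)
  · by_contra! hlt
    have h : mrank (S.map g) q ≤ mrank S (mselect S k - 1) := by
      rw [mrank_map]
      refine Multiset.card_le_card (Multiset.monotone_filter_right S fun i hi => ?_)
      exact Int.le_sub_one_of_lt (hg.1.reflect_lt (hi.trans_lt hlt))
    have hle := hleast.2 (show k ≤ (mrank S (mselect S k - 1) : ℤ) from
      le_trans hq (by exact_mod_cast h))
    omega
end

section
/- Let S be a finite multiset of integers and let j ∈ ℤ. Then rank_S(j) = select_{rank_S(ℤ)}(rank_{⟨S⟩}(j) + 1). -/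
theorem mrank_mono (S : Multiset ℤ) : Monotone (mrank S) := fun _ _ h =>
  Multiset.card_le_card (Multiset.monotone_filter_right S fun _ hx => le_trans hx h)

theorem mrank_lt_mrank {S : Multiset ℤ} {x y : ℤ} (hy : y ∈ S) (h : x < y) :
    mrank S x < mrank S y := by
  refine Multiset.card_lt_card (lt_of_le_of_ne
    (Multiset.monotone_filter_right S fun _ hx => le_trans hx h.le) fun he => ?_)
  have hm : y ∈ S.filter (· ≤ y) := Multiset.mem_filter.2 ⟨hy, le_rfl⟩
  rw [← he] at hm
  exact absurd (Multiset.mem_filter.1 hm).2 (not_le.2 h)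

theorem mrank_pos {S : Multiset ℤ} {y : ℤ} (hy : y ∈ S) : 0 < mrank S y :=
  (Nat.zero_le _).trans_lt (mrank_lt_mrank hy (sub_one_lt y))

theorem mrank_eq_zero_or_exists_mem (S : Multiset ℤ) (k : ℤ) :
    mrank S k = 0 ∨ ∃ m ∈ S, m ≤ k ∧ mrank S m = mrank S k := by
  rcases (S.filter (· ≤ k)).toFinset.eq_empty_or_nonempty with h | h
  · left
    rw [Multiset.toFinset_eq_empty] at h
    simp [mrank, h]
  · right
    obtain ⟨m, hm, hle⟩ := Finset.exists_max_image _ id h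
    simp only [Multiset.mem_toFinset, Multiset.mem_filter, id] at hm hle
    refine ⟨m, hm.1, hm.2, congrArg Multiset.card (Multiset.filter_congr fun x hx => ?_)⟩
    exact ⟨fun hxm => hxm.trans hm.2, fun hxk => hle x ⟨hx, hxk⟩⟩

theorem exists_mrank_eq_zero (S : Multiset ℤ) : ∃ k, mrank S k = 0 := by
  obtain ⟨b, hb⟩ := S.toFinset.bddBelow
  refine ⟨b - 1, ?_⟩
  rw [mrank, Multiset.card_eq_zero, Multiset.filter_eq_nil]
  intro x hx hxb
  have : b ≤ x := hb (by simpa using hx)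
  lia

theorem rankImage_le_mrank (S : Multiset ℤ) (j : ℤ) :
    {v ∈ rankImage S | v ≤ (mrank S j : ℤ)} =
      insert 0 ((fun x => (mrank S x : ℤ)) '' {x ∈ msupp S | x ≤ j}) := by
  ext v
  constructor
  · rintro ⟨⟨k, rfl⟩, hk⟩
    have hmin : mrank S (min k j) = mrank S k := by
      rw [(mrank_mono S).map_min]
      exact min_eq_left (Nat.cast_le.1 hk)
    rcases mrank_eq_zero_or_exists_mem S (min k j) with h | ⟨m, hm, hle, h⟩
    · left
      simp [← hmin, h]
    · right
      exact ⟨m, ⟨hm, hle.trans (min_le_right _ _)⟩, by simp [h, hmin]⟩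
  · rintro (rfl | ⟨x, ⟨-, hx⟩, rfl⟩)
    · obtain ⟨k, hk⟩ := exists_mrank_eq_zero S
      exact ⟨⟨k, by simp [hk]⟩, by positivity⟩
    · exact ⟨⟨x, rfl⟩, Nat.cast_le.2 (mrank_mono S hx)⟩

theorem finite_msupp (S : Multiset ℤ) : (msupp S).Finite :=
  S.toFinset.finite_toSet.subset fun _ hx => Multiset.mem_toFinset.2 hx

theorem srank_rankImage_mrank (S : Multiset ℤ) (j : ℤ) :
    srank (rankImage S) (mrank S j) = srank (msupp S) j + 1 := by
  have hfin : {x ∈ msupp S | x ≤ j}.Finite := (finite_msupp S).subset fun _ hx => hx.1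
  rw [srank, rankImage_le_mrank, Set.ncard_insert_of_notMem _ (hfin.image _),
    Set.InjOn.ncard_image, srank]
  · intro x hx y hy hxy
    have hxy' : mrank S x = mrank S y := Nat.cast_injective hxy
    rcases lt_trichotomy x y with h | h | h
    · exact absurd hxy' (mrank_lt_mrank hy.1 h).ne
    · exact h
    · exact absurd hxy' (mrank_lt_mrank hx.1 h).ne'
  · rintro ⟨x, hx, h0⟩
    exact (mrank_pos hx.1).ne' (Nat.cast_eq_zero.1 h0)

theorem stmt3 (S : Multiset ℤ) (j : ℤ) :
    (mrank S j : ℤ) = sselect (rankImage S) ((srank (msupp S) j : ℤ) + 1) := by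
  refine (IsLeast.csInf_eq ⟨?_, fun t ht => ?_⟩).symm
  · rw [Set.mem_ofPred_eq, srank_rankImage_mrank]
    simp
  · by_contra! hlt
    have hfin : {v ∈ rankImage S | v ≤ (mrank S j : ℤ)}.Finite := by
      rw [rankImage_le_mrank]
      exact (((finite_msupp S).subset fun _ hx => hx.1).image _).insert _
    have hcard : srank (rankImage S) t < srank (rankImage S) (mrank S j) := by
      refine Set.ncard_lt_ncard ⟨fun v hv => ⟨hv.1, hv.2.trans hlt.le⟩, fun hsub => ?_⟩ hfin
      exact absurd (hsub ⟨⟨j, rfl⟩, le_rfl⟩).2 (not_le.2 hlt)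
    rw [srank_rankImage_mrank] at hcard
    rw [Set.mem_ofPred_eq] at ht
    lia
end
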